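/- Let n ≥ 2 and let σ_1,…,σ_{n−1} be the standard Artin generators of B_n, and set Δ_n² = (σ_1⋯σ_{n−1})^n. Then any two factorizations Δ_n² = σ_{i_1}⋯σ_{i_{n(n−1)}} = σ_{j_1}⋯σ_{j_{n(n−1)}} with all indices i_k, j_k ∈ {1,…,n−1} are Hurwitz equivalent, i.e. the tuples (σ_{i_1},…,σ_{i_{n(n−1)}}) and (σ_{j_1},…,σ_{j_{n(n−1)}}) in (B_n)^{n(n−1)} are Hurwitz equivalent. -/

import Mathlib

/-- The braid relators on generators indexed by `Fin n` (so this presents the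
braid group on `n + 1` strands): `σᵢσⱼ = σⱼσᵢ` for `|i - j| > 1` and
`σᵢσᵢ₊₁σᵢ = σᵢ₊₁σᵢσᵢ₊₁`. -/
def braidRels (n : ℕ) : Set (FreeGroup (Fin n)) :=
  {r | ∃ i j : Fin n, i.val + 2 ≤ j.val ∧
        r = FreeGroup.of i * FreeGroup.of j * (FreeGroup.of j * FreeGroup.of i)⁻¹} ∪
  {r | ∃ i j : Fin n, i.val + 1 = j.val ∧
        r = FreeGroup.of i * FreeGroup.of j * FreeGroup.of i *
            (FreeGroup.of j * FreeGroup.of i * FreeGroup.of j)⁻¹}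

/-- The braid group with `n` Artin generators, i.e. the braid group `B_{n+1}`
on `n + 1` strands. -/
abbrev BraidGroup (n : ℕ) : Type := PresentedGroup (braidRels n)

/-- The Artin generators (zero-based: `σ 0, …, σ (n-1)` are the paper's
`σ₁, …, σₙ`). -/
def σ {n : ℕ} (i : Fin n) : BraidGroup n := PresentedGroup.of i

/-- A single Hurwitz move `R_k` (the position `k` is encoded by the prefix `u`):
`(…, a, b, …) ↦ (…, a b a⁻¹, a, …)`. -/
def HurwitzMove {G : Type*} [Group G] (l l' : List G) : Prop :=
  ∃ (u v : List G) (a b : G),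
    l = u ++ a :: b :: v ∧ l' = u ++ (a * b * a⁻¹) :: a :: v

/-- Hurwitz equivalence: finite sequences of Hurwitz moves and their inverses. -/
def HurwitzEquiv {G : Type*} [Group G] : List G → List G → Prop :=
  Relation.EqvGen HurwitzMove

/-- `Δₙ² = (σ₁ ⋯ σₙ₋₁)ⁿ`, the generator of the center of `Bₙ` (here `Bₙ`
is `BraidGroup (n - 1)`, with `n - 1` Artin generators). -/
def DeltaSq (n : ℕ) : BraidGroup (n - 1) :=
  ((List.ofFn fun i : Fin (n - 1) => σ i).prod) ^ n

/-- Positive equivalence of words in the Artin generators. -/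
inductive BraidEquiv {n : ℕ} : List (Fin n) → List (Fin n) → Prop
  | refl (u) : BraidEquiv u u
  | trans {u v w} : BraidEquiv u v → BraidEquiv v w → BraidEquiv u w
  | cons (i) {u v} : BraidEquiv u v → BraidEquiv (i :: u) (i :: v)
  | comm {i j : Fin n} (w) (h : i.val + 2 ≤ j.val ∨ j.val + 2 ≤ i.val) :
      BraidEquiv (i :: j :: w) (j :: i :: w)
  | braid {i j : Fin n} (w) (h : i.val + 1 = j.val ∨ j.val + 1 = i.val) :
      BraidEquiv (i :: j :: i :: w) (j :: i :: j :: w)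

namespace BraidEquiv

variable {n : ℕ} {u v w : List (Fin n)}

theorem symm (h : BraidEquiv u v) : BraidEquiv v u := by
  induction h with
  | refl => exact refl _
  | trans _ _ ih₁ ih₂ => exact ih₂.trans ih₁
  | cons i _ ih => exact ih.cons i
  | comm w h => exact comm w h.symm
  | braid w h => exact braid w h.symm

theorem length_eq (h : BraidEquiv u v) : u.length = v.length := by
  induction h <;> simp_all

theorem append_left (t : List (Fin n)) (h : BraidEquiv u v) : BraidEquiv (t ++ u) (t ++ v) := by
  induction t with
  | nil => exact h
  | cons i t ih => exact ih.cons i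

theorem append_right (t : List (Fin n)) (h : BraidEquiv u v) : BraidEquiv (u ++ t) (v ++ t) := by
  induction h with
  | refl => exact refl _
  | trans _ _ ih₁ ih₂ => exact ih₁.trans ih₂
  | cons i _ ih => exact ih.cons i
  | comm w h => exact comm _ h
  | braid w h => exact braid _ h

end BraidEquiv

/-- `HeadRel i X j Y` says that the words `i :: X` and `j :: Y` are both equivalent to words
extending the least common multiple of the letters `i` and `j` by one and the same tail. -/
inductive HeadRel {n : ℕ} : Fin n → List (Fin n) → Fin n → List (Fin n) → Prop
  | same {i X Y} : BraidEquiv X Y → HeadRel i X i Y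
  | far {i j : Fin n} {X Y} (Z) : (i.val + 2 ≤ j.val ∨ j.val + 2 ≤ i.val) →
      BraidEquiv X (j :: Z) → BraidEquiv Y (i :: Z) → HeadRel i X j Y
  | adj {i j : Fin n} {X Y} (Z) : (i.val + 1 = j.val ∨ j.val + 1 = i.val) →
      BraidEquiv X (j :: i :: Z) → BraidEquiv Y (i :: j :: Z) → HeadRel i X j Y

namespace HeadRel

open BraidEquiv

variable {n : ℕ} {i j k : Fin n} {X Y W : List (Fin n)}

theorem symm (h : HeadRel i X j Y) : HeadRel j Y i X := by
  cases h with
  | same h => exact same h.symm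
  | far Z h h₁ h₂ => exact far Z h.symm h₂ h₁
  | adj Z h h₁ h₂ => exact adj Z h.symm h₂ h₁

theorem tail_equiv (h : HeadRel i X i Y) : BraidEquiv X Y := by
  cases h with
  | same h => exact h
  | far Z h => omega
  | adj Z h => omega

theorem exists_of_far (h : HeadRel i X j Y) (hij : i.val + 2 ≤ j.val ∨ j.val + 2 ≤ i.val) :
    ∃ Z, BraidEquiv X (j :: Z) ∧ BraidEquiv Y (i :: Z) := by
  cases h with
  | same h => omega
  | far Z h h₁ h₂ => exact ⟨Z, h₁, h₂⟩
  | adj Z h => omega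

theorem exists_of_adj (h : HeadRel i X j Y) (hij : i.val + 1 = j.val ∨ j.val + 1 = i.val) :
    ∃ Z, BraidEquiv X (j :: i :: Z) ∧ BraidEquiv Y (i :: j :: Z) := by
  cases h with
  | same h => omega
  | far Z h => omega
  | adj Z h h₁ h₂ => exact ⟨Z, h₁, h₂⟩

theorem of_equiv (h₁ : BraidEquiv X W) (h : HeadRel i W j Y) : HeadRel i X j Y := by
  cases h with
  | same h => exact same (h₁.trans h)
  | far Z h h₂ h₃ => exact far Z h (h₁.trans h₂) h₃
  | adj Z h h₂ h₃ => exact adj Z h (h₁.trans h₂) h₃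

section Trans

variable
  (IH : ∀ i j X Y, X.length < W.length → BraidEquiv (i :: X) (j :: Y) → HeadRel (n := n) i X j Y)

include IH

theorem trans_far_far {Z Z' : List (Fin n)}
    (hik : i.val + 2 ≤ k.val ∨ k.val + 2 ≤ i.val) (hkj : k.val + 2 ≤ j.val ∨ j.val + 2 ≤ k.val)
    (hX : BraidEquiv X (k :: Z)) (hW : BraidEquiv W (i :: Z))
    (hW' : BraidEquiv W (j :: Z')) (hY : BraidEquiv Y (k :: Z')) : HeadRel i X j Y := by
  have hl := hW.length_eq
  simp only [List.length_cons] at hl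
  cases IH i j Z Z' (by omega) (hW.symm.trans hW') with
  | same h => exact same (hX.trans ((h.cons k).trans hY.symm))
  | far U h h₁ h₂ =>
    exact far (k :: U) h (hX.trans ((h₁.cons k).trans (comm U hkj)))
      (hY.trans ((h₂.cons k).trans (comm U hik.symm)))
  | adj U h h₁ h₂ =>
    exact adj (k :: U) h
      (hX.trans ((h₁.cons k).trans ((comm _ hkj).trans ((comm U hik.symm).cons j))))
      (hY.trans ((h₂.cons k).trans ((comm _ hik.symm).trans ((comm U hkj).cons i))))

theorem trans_far_adj {Z Z' : List (Fin n)}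
    (hik : i.val + 2 ≤ k.val ∨ k.val + 2 ≤ i.val) (hkj : k.val + 1 = j.val ∨ j.val + 1 = k.val)
    (hX : BraidEquiv X (k :: Z)) (hW : BraidEquiv W (i :: Z))
    (hW' : BraidEquiv W (j :: k :: Z')) (hY : BraidEquiv Y (k :: j :: Z')) :
    HeadRel i X j Y := by
  have hl := hW.length_eq
  have hl' := hW'.length_eq
  simp only [List.length_cons] at hl hl'
  cases IH i j Z (k :: Z') (by omega) (hW.symm.trans hW') with
  | same h => omega
  | far U h h₁ h₂ =>
    obtain ⟨V, hV₁, hV₂⟩ := (IH k i Z' U (by omega) h₂).exists_of_far hik.symm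
    refine far (k :: j :: V) h ?_ ?_
    · exact hX.trans ((h₁.cons k).trans (((hV₂.cons j).cons k).trans (braid V hkj)))
    · exact hY.trans (((hV₁.cons j).cons k).trans
        (((comm V h.symm).cons k).trans (comm _ hik.symm)))
  | adj U h h₁ h₂ =>
    obtain ⟨V, hV₁, hV₂⟩ := (IH k i Z' (j :: U) (by omega) h₂).exists_of_far hik.symm
    have hlU := hV₂.length_eq
    have hlV := hV₁.length_eq
    simp only [List.length_cons] at hlU hlV
    obtain ⟨T, hT₁, hT₂⟩ := (IH j k U V (by omega) hV₂).exists_of_adj hkj.symm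
    refine adj (k :: j :: i :: T) h ?_ ?_
    · refine hX.trans ((h₁.cons k).trans ((((hT₁.cons i).cons j).cons k).trans ?_))
      refine (((comm (j :: T) hik).cons j).cons k).trans ?_
      refine (braid (i :: j :: T) hkj).trans ?_
      refine ((((braid T h.symm).cons k).cons j)).trans ?_
      exact (comm (j :: i :: T) hik.symm).cons j
    · refine hY.trans ((((hV₁.trans (hT₂.cons i)).cons j).cons k).trans ?_)
      refine ((braid (k :: T) h.symm).cons k).trans ?_
      refine (comm (j :: i :: k :: T) hik.symm).trans ?_
      refine ((((comm T hik).cons j).cons k).cons i).trans ?_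
      exact (braid (i :: T) hkj).cons i

theorem trans_adj_adj {Z Z' : List (Fin n)}
    (hik : i.val + 1 = k.val ∨ k.val + 1 = i.val) (hkj : k.val + 1 = j.val ∨ j.val + 1 = k.val)
    (hX : BraidEquiv X (k :: i :: Z)) (hW : BraidEquiv W (i :: k :: Z))
    (hW' : BraidEquiv W (j :: k :: Z')) (hY : BraidEquiv Y (k :: j :: Z')) :
    HeadRel i X j Y := by
  have hl := hW.length_eq
  have hl' := hW'.length_eq
  simp only [List.length_cons] at hl hl'
  have hWW := hW.symm.trans hW'
  cases IH i j (k :: Z) (k :: Z') (by simp only [List.length_cons]; omega) hWW with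
  | same h =>
    have hZ := (IH k k Z Z' (by omega) h).tail_equiv
    exact same (hX.trans (((hZ.cons i).cons k).trans hY.symm))
  | far U h h₁ h₂ =>
    obtain ⟨V, hV₁, hV₂⟩ := (IH k j Z U (by omega) h₁).exists_of_adj hkj
    obtain ⟨V', hV₁', hV₂'⟩ := (IH k i Z' U (by omega) h₂).exists_of_adj hik.symm
    have hlV := hV₁.length_eq
    simp only [List.length_cons] at hlV
    have hVV := (IH k k (j :: V) (i :: V') (by simp only [List.length_cons]; omega)
      (hV₂.symm.trans hV₂')).tail_equiv
    obtain ⟨T, hT₁, hT₂⟩ := (IH j i V V' (by omega) hVV).exists_of_far h.symm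
    refine far (k :: i :: j :: k :: T) h ?_ ?_
    · refine hX.trans ((((hV₁.trans ((hT₁.cons k).cons j)).cons i).cons k).trans ?_)
      refine ((comm (k :: i :: T) h).cons k).trans ?_
      refine (((braid T hik).cons j).cons k).trans ?_
      refine (braid (i :: k :: T) hkj).trans ?_
      exact ((comm (k :: T) h.symm).cons k).cons j
    · refine hY.trans ((((hV₁'.trans ((hT₂.cons k).cons i)).cons j).cons k).trans ?_)
      refine ((comm (k :: j :: T) h.symm).cons k).trans ?_
      refine (((braid T hkj.symm).cons i).cons k).trans ?_
      exact braid (j :: k :: T) hik.symm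
  | adj U h => omega

protected theorem trans (h₁ : HeadRel i X k W) (h₂ : HeadRel k W j Y) : HeadRel i X j Y := by
  cases h₁ with
  | same h => exact of_equiv h h₂
  | far Z hik hX hW =>
    cases h₂ with
    | same h => exact (of_equiv h.symm (far Z hik hX hW).symm).symm
    | far Z' hkj hW' hY => exact trans_far_far IH hik hkj hX hW hW' hY
    | adj Z' hkj hW' hY => exact trans_far_adj IH hik hkj hX hW hW' hY
  | adj Z hik hX hW =>
    cases h₂ with
    | same h => exact (of_equiv h.symm (adj Z hik hX hW).symm).symm
    | far Z' hkj hW' hY => exact (trans_far_adj IH hkj.symm hik.symm hY hW' hW hX).symm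
    | adj Z' hkj hW' hY => exact trans_adj_adj IH hik hkj hX hW hW' hY

end Trans

end HeadRel

/-- Garside's lemma on positive words with prescribed first letters. -/
theorem BraidEquiv.headRel {n : ℕ} (i j : Fin n) (X Y : List (Fin n))
    (h : BraidEquiv (i :: X) (j :: Y)) : HeadRel i X j Y := by
  induction hN : X.length using Nat.strong_induction_on generalizing i j X Y with
  | _ N IH =>
    generalize hu : i :: X = u at h
    generalize hv : j :: Y = v at h
    induction h generalizing i j X Y with
    | refl => cases hu; cases hv; exact .same (.refl _)
    | @trans u w v h₁ h₂ ih₁ ih₂ =>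
      subst hu hv
      have hl := h₁.length_eq
      cases w with
      | nil => simp at hl
      | cons k W =>
        simp only [List.length_cons, Nat.add_right_cancel_iff] at hl
        exact HeadRel.trans (fun i j X Y hX h => IH _ (by omega) i j X Y h rfl)
          (ih₁ i k X W hN rfl rfl) (ih₂ k j W Y (by omega) rfl rfl)
    | cons _ h => cases hu; cases hv; exact .same h
    | comm w h => cases hu; cases hv; exact .far w h (.refl _) (.refl _)
    | braid w h => cases hu; cases hv; exact .adj w h (.refl _) (.refl _)

/-- The congruence on words whose quotient is the braid monoid. -/
def braidCon (n : ℕ) : Con (FreeMonoid (Fin n)) where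
  r := BraidEquiv
  iseqv := ⟨.refl, .symm, .trans⟩
  mul' {_ x y _} h₁ h₂ := (h₁.append_right y).trans (h₂.append_left x)

/-- The monoid of positive braids with `n` Artin generators. -/
abbrev BraidMonoid (n : ℕ) : Type := (braidCon n).Quotient

namespace BraidMonoid

variable {n : ℕ}

/-- The Artin generators of the braid monoid. -/
def gen (i : Fin n) : BraidMonoid n := (braidCon n).mk' (FreeMonoid.of i)

theorem gen_comm {i j : Fin n} (h : i.val + 2 ≤ j.val ∨ j.val + 2 ≤ i.val) :
    gen i * gen j = gen j * gen i :=
  (Con.eq _).2 (BraidEquiv.comm [] h)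

theorem gen_braid {i j : Fin n} (h : i.val + 1 = j.val ∨ j.val + 1 = i.val) :
    gen i * gen j * gen i = gen j * gen i * gen j :=
  (Con.eq _).2 (BraidEquiv.braid [] h)

theorem mk_eq_prod (u : List (Fin n)) :
    (braidCon n).mk' (FreeMonoid.ofList u) = (u.map gen).prod := by
  induction u with
  | nil => rfl
  | cons i u ih => rw [List.map_cons, List.prod_cons, ← ih]; rfl

@[elab_as_elim]
theorem induction_gen {p : BraidMonoid n → Prop} (one : p 1)
    (gen_mul : ∀ i x, p x → p (gen i * x)) (x : BraidMonoid n) : p x := by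
  obtain ⟨u, rfl⟩ := Con.mk'_surjective x
  change p ((braidCon n).mk' (FreeMonoid.ofList u.toList))
  rw [mk_eq_prod]
  induction u.toList with
  | nil => exact one
  | cons i u ih => exact gen_mul i _ ih

theorem gen_mul_left_cancel {i : Fin n} {x y : BraidMonoid n} (h : gen i * x = gen i * y) :
    x = y := by
  obtain ⟨u, rfl⟩ := Con.mk'_surjective x
  obtain ⟨v, rfl⟩ := Con.mk'_surjective y
  exact (Con.eq _).2 (BraidEquiv.headRel i i u v ((Con.eq _).1 h)).tail_equiv

theorem mul_left_cancel' {z x y : BraidMonoid n} (h : z * x = z * y) : x = y := by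
  induction z using induction_gen with
  | one => simpa using h
  | gen_mul i z ih => exact ih (gen_mul_left_cancel (by simpa [mul_assoc] using h))

end BraidMonoid

section CoxeterElement

variable {M : Type*} [Monoid M] {n : ℕ} {f : ℕ → M}

theorem commute_prod_range (hc : ∀ i j, i + 2 ≤ j → j < n → f i * f j = f j * f i)
    {k j : ℕ} (hkj : k + 1 ≤ j) (hj : j < n) : Commute ((List.range k).map f).prod (f j) := by
  apply Commute.list_prod_left
  simp only [List.mem_map, List.mem_range]
  rintro _ ⟨i, hi, rfl⟩
  exact hc i j (by omega) hj

theorem prod_range_mul (hc : ∀ i j, i + 2 ≤ j → j < n → f i * f j = f j * f i)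
    (hb : ∀ i, i + 1 < n → f i * f (i + 1) * f i = f (i + 1) * f i * f (i + 1))
    {i k : ℕ} (hik : i + 2 ≤ k) (hk : k ≤ n) :
    ((List.range k).map f).prod * f i = f (i + 1) * ((List.range k).map f).prod := by
  induction k, hik using Nat.le_induction with
  | base =>
    have h := commute_prod_range hc (le_refl (i + 1)) (by omega)
    rw [List.prod_range_succ, List.prod_range_succ, mul_assoc, mul_assoc, ← mul_assoc (f i),
      hb i (by omega), ← mul_assoc, ← mul_assoc, h.eq]
    simp only [mul_assoc]
  | succ k hik ih =>
    rw [List.prod_range_succ, mul_assoc, ← hc i k hik (by omega), ← mul_assoc, ih (by omega),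
      mul_assoc]

theorem prod_range_pow_mul (hc : ∀ i j, i + 2 ≤ j → j < n → f i * f j = f j * f i)
    (hb : ∀ i, i + 1 < n → f i * f (i + 1) * f i = f (i + 1) * f i * f (i + 1))
    {i a : ℕ} (h : i + a < n) :
    ((List.range n).map f).prod ^ a * f i = f (i + a) * ((List.range n).map f).prod ^ a := by
  induction a with
  | zero => simp
  | succ a ih =>
    rw [pow_succ', mul_assoc, ih (by omega), ← mul_assoc,
      prod_range_mul hc hb (by omega) le_rfl, mul_assoc, add_assoc]

theorem prod_range_sq_mul (hc : ∀ i j, i + 2 ≤ j → j < n + 1 → f i * f j = f j * f i)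
    (hb : ∀ i, i + 1 < n + 1 → f i * f (i + 1) * f i = f (i + 1) * f i * f (i + 1)) :
    ((List.range (n + 1)).map f).prod ^ 2 * f n = f 0 * ((List.range (n + 1)).map f).prod ^ 2 := by
  have shift : ∀ k ≤ n, ((List.range (n + 1)).map f).prod * ((List.range k).map f).prod =
      ((List.range k).map fun i => f (i + 1)).prod * ((List.range (n + 1)).map f).prod := by
    intro k hk
    induction k with
    | zero => simp
    | succ k ih =>
      rw [List.prod_range_succ f k, ← mul_assoc, ih (by omega), mul_assoc,
        prod_range_mul hc hb (by omega) le_rfl, ← mul_assoc,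
        List.prod_range_succ (fun i => f (i + 1)) k]
  have h := shift n le_rfl
  have hl : ((List.range (n + 1)).map f).prod =
      f 0 * ((List.range n).map fun i => f (i + 1)).prod := List.prod_range_succ' f n
  generalize hδ : ((List.range (n + 1)).map f).prod = δ at *
  have hr : ((List.range n).map f).prod * f n = δ := by rw [← hδ, List.prod_range_succ]
  calc δ ^ 2 * f n = f 0 * (((List.range n).map fun i => f (i + 1)).prod * δ) * f n := by
        rw [pow_two]; nth_rw 1 [hl]; simp only [mul_assoc]
    _ = f 0 * δ ^ 2 := by rw [← h, pow_two, mul_assoc, mul_assoc, hr]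

theorem prod_range_pow_succ_comm (hc : ∀ i j, i + 2 ≤ j → j < n → f i * f j = f j * f i)
    (hb : ∀ i, i + 1 < n → f i * f (i + 1) * f i = f (i + 1) * f i * f (i + 1))
    {i : ℕ} (hi : i < n) :
    ((List.range n).map f).prod ^ (n + 1) * f i = f i * ((List.range n).map f).prod ^ (n + 1) := by
  obtain ⟨m, rfl⟩ : ∃ m, n = m + 1 := ⟨n - 1, by omega⟩
  have h₁ := prod_range_pow_mul hc hb (i := i) (a := m - i) (by omega)
  have h₂ := prod_range_sq_mul hc hb
  have h₃ := prod_range_pow_mul hc hb (i := 0) (a := i) (by omega)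
  rw [show i + (m - i) = m by omega] at h₁
  rw [zero_add] at h₃
  generalize ((List.range (m + 1)).map f).prod = δ at *
  rw [show m + 1 + 1 = i + 2 + (m - i) by omega, pow_add, mul_assoc, h₁, pow_add, mul_assoc,
    ← mul_assoc (δ ^ 2), h₂, ← mul_assoc, ← mul_assoc, h₃]
  simp only [mul_assoc]

theorem dvd_prod_range_pow_succ (hc : ∀ i j, i + 2 ≤ j → j < n → f i * f j = f j * f i)
    (hb : ∀ i, i + 1 < n → f i * f (i + 1) * f i = f (i + 1) * f i * f (i + 1))
    {i : ℕ} (hi : i < n) : f i ∣ ((List.range n).map f).prod ^ (n + 1) := by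
  have h := prod_range_pow_mul hc hb (i := 0) (a := i) (by omega)
  obtain ⟨r, hr⟩ : f 0 ∣ ((List.range n).map f).prod := by
    obtain ⟨m, rfl⟩ : ∃ m, n = m + 1 := ⟨n - 1, by omega⟩
    exact ⟨_, List.prod_range_succ' f m⟩
  rw [zero_add] at h
  generalize ((List.range n).map f).prod = δ at *
  refine ⟨δ ^ i * (r * δ ^ (n - i)), ?_⟩
  rw [← mul_assoc, ← h, mul_assoc, ← mul_assoc (f 0), ← hr, ← pow_succ', ← pow_add]
  congr 1
  omega

end CoxeterElement

namespace BraidMonoid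

variable {n : ℕ}

/-- The generators of the braid monoid, indexed by all natural numbers with junk value `1`. -/
def natGen (n i : ℕ) : BraidMonoid n := if h : i < n then gen ⟨i, h⟩ else 1

theorem natGen_val (i : Fin n) : natGen n i = gen i := by simp [natGen]

theorem natGen_comm (i j : ℕ) (hij : i + 2 ≤ j) (hj : j < n) :
    natGen n i * natGen n j = natGen n j * natGen n i := by
  rw [natGen, natGen, dif_pos hj, dif_pos (by omega)]
  exact gen_comm (Or.inl hij)

theorem natGen_braid (i : ℕ) (hi : i + 1 < n) :
    natGen n i * natGen n (i + 1) * natGen n i =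
      natGen n (i + 1) * natGen n i * natGen n (i + 1) := by
  rw [natGen, natGen, dif_pos hi, dif_pos (by omega)]
  exact gen_braid (Or.inl rfl)

/-- The full twist as a positive braid. -/
def fullTwist (n : ℕ) : BraidMonoid n := ((List.range n).map (natGen n)).prod ^ (n + 1)

theorem fullTwist_commute (x : BraidMonoid n) : Commute (fullTwist n) x := by
  induction x using induction_gen with
  | one => exact Commute.one_right _
  | gen_mul i x ih =>
    refine Commute.mul_right ?_ ih
    rw [← natGen_val]
    exact prod_range_pow_succ_comm natGen_comm natGen_braid i.isLt

theorem gen_dvd_fullTwist (i : Fin n) : gen i ∣ fullTwist n := by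
  rw [← natGen_val]
  exact dvd_prod_range_pow_succ natGen_comm natGen_braid i.isLt

theorem commute_of_mem_powers {s : BraidMonoid n} (hs : s ∈ Submonoid.powers (fullTwist n))
    (x : BraidMonoid n) : s * x = x * s := by
  obtain ⟨k, rfl⟩ := hs
  exact (fullTwist_commute x).pow_left k

instance : OreLocalization.OreSet (Submonoid.powers (fullTwist n)) where
  ore_right_cancel x y s h :=
    ⟨s, by rw [commute_of_mem_powers s.2, commute_of_mem_powers s.2, h]⟩
  oreNum x _ := x
  oreDenom _ s := s
  ore_eq x s := commute_of_mem_powers s.2 x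

/-- The braid monoid with the full twist inverted. -/
abbrev Fractions (n : ℕ) : Type := OreLocalization (Submonoid.powers (fullTwist n)) (BraidMonoid n)

/-- The canonical map from the braid monoid to its localization at the full twist. -/
def toFractions : BraidMonoid n →* Fractions n := OreLocalization.numeratorHom

theorem toFractions_injective : Function.Injective (toFractions (n := n)) := by
  intro x y h
  obtain ⟨s, t, h₁, h₂⟩ := OreLocalization.oreDiv_eq_iff.1 h
  have hst : (s : BraidMonoid n) = t := by simpa using h₂
  subst hst
  exact (mul_left_cancel' h₁).symm

theorem isUnit_toFractions_gen (i : Fin n) : IsUnit (toFractions (gen i)) := by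
  obtain ⟨r, hr⟩ := gen_dvd_fullTwist i
  have hc : Commute (gen i) r := by
    apply gen_mul_left_cancel (i := i)
    rw [← mul_assoc (gen i) r, ← hr]
    exact (fullTwist_commute (gen i)).eq.symm
  have hu : IsUnit (toFractions (fullTwist n)) :=
    OreLocalization.numerator_isUnit (⟨_, Submonoid.mem_powers _⟩ : Submonoid.powers (fullTwist n))
  have hm : toFractions (fullTwist n) = toFractions (gen i) * toFractions r := by
    rw [← map_mul, ← hr]
  exact ((hc.map toFractions).isUnit_mul_iff.1 (hm ▸ hu)).1

/-- The homomorphism from the braid group to the units of the localized braid monoid. -/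
noncomputable def groupToUnits (n : ℕ) : BraidGroup n →* (Fractions n)ˣ :=
  PresentedGroup.toGroup (f := fun i => (isUnit_toFractions_gen i).unit) <| by
    rintro r (⟨i, j, h, rfl⟩ | ⟨i, j, h, rfl⟩)
    · rw [map_mul, map_inv, mul_inv_eq_one]
      apply Units.ext
      simp only [map_mul, FreeGroup.lift_apply_of, Units.val_mul, IsUnit.unit_spec]
      rw [← map_mul, ← map_mul, gen_comm (Or.inl h)]
    · rw [map_mul, map_inv, mul_inv_eq_one]
      apply Units.ext
      simp only [map_mul, FreeGroup.lift_apply_of, Units.val_mul, IsUnit.unit_spec]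
      rw [← map_mul, ← map_mul, ← map_mul, ← map_mul, gen_braid (Or.inl h)]

theorem groupToUnits_σ (i : Fin n) : (groupToUnits n (σ i) : Fractions n) = toFractions (gen i) := by
  simp [groupToUnits, σ]

theorem groupToUnits_prod (u : List (Fin n)) :
    (groupToUnits n (u.map σ).prod : Fractions n) = toFractions (u.map gen).prod := by
  induction u with
  | nil => simp
  | cons i u ih => simp [ih, groupToUnits_σ]

end BraidMonoid

/-- Garside's embedding theorem: positive words representing the same braid are
positively equivalent. -/
theorem BraidEquiv.of_prod_eq {n : ℕ} {u v : List (Fin n)}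
    (h : (u.map σ).prod = (v.map σ).prod) : BraidEquiv u v := by
  have h' : (u.map BraidMonoid.gen).prod = (v.map BraidMonoid.gen).prod := by
    apply BraidMonoid.toFractions_injective
    rw [← BraidMonoid.groupToUnits_prod, h, BraidMonoid.groupToUnits_prod]
  rw [← BraidMonoid.mk_eq_prod, ← BraidMonoid.mk_eq_prod] at h'
  exact (Con.eq _).1 h'

theorem σ_comm {n : ℕ} {i j : Fin n} (h : i.val + 2 ≤ j.val ∨ j.val + 2 ≤ i.val) :
    σ i * σ j = σ j * σ i := by
  have key : ∀ i j : Fin n, i.val + 2 ≤ j.val → σ i * σ j = σ j * σ i := fun i j h =>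
    mul_inv_eq_one.1 (PresentedGroup.one_of_mem (rels := braidRels n) (Or.inl ⟨i, j, h, rfl⟩))
  exact h.elim (key i j) fun h => (key j i h).symm

theorem σ_braid {n : ℕ} {i j : Fin n} (h : i.val + 1 = j.val ∨ j.val + 1 = i.val) :
    σ i * σ j * σ i = σ j * σ i * σ j := by
  have key : ∀ i j : Fin n, i.val + 1 = j.val → σ i * σ j * σ i = σ j * σ i * σ j := fun i j h =>
    mul_inv_eq_one.1 (PresentedGroup.one_of_mem (rels := braidRels n) (Or.inr ⟨i, j, h, rfl⟩))
  exact h.elim (key i j) fun h => (key j i h).symm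

theorem HurwitzEquiv.cons {G : Type*} [Group G] (g : G) {l l' : List G} (h : HurwitzEquiv l l') :
    HurwitzEquiv (g :: l) (g :: l') := by
  induction h with
  | rel _ _ h =>
    obtain ⟨u, v, a, b, rfl, rfl⟩ := h
    exact .rel _ _ ⟨g :: u, v, a, b, rfl, rfl⟩
  | refl => exact .refl _
  | symm _ _ _ ih => exact .symm _ _ ih
  | trans _ _ _ _ _ ih₁ ih₂ => exact .trans _ _ _ ih₁ ih₂

theorem HurwitzEquiv.swap_conj {G : Type*} [Group G] (a b : G) (l : List G) :
    HurwitzEquiv (a :: b :: l) (a * b * a⁻¹ :: a :: l) :=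
  .rel _ _ ⟨[], l, a, b, rfl, rfl⟩

/-- Positively equivalent words give Hurwitz equivalent factorizations. -/
theorem BraidEquiv.hurwitzEquiv {n : ℕ} {u v : List (Fin n)} (h : BraidEquiv u v) :
    HurwitzEquiv (u.map (σ (n := n))) (v.map σ) := by
  induction h with
  | refl => exact .refl _
  | trans _ _ ih₁ ih₂ => exact .trans _ _ _ ih₁ ih₂
  | cons i _ ih => exact ih.cons _
  | @comm i j w h =>
    have := HurwitzEquiv.swap_conj (σ i) (σ j) (w.map σ)
    rwa [σ_comm h, mul_inv_cancel_right] at this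
  | @braid i j w h =>
    have h₁ := (HurwitzEquiv.swap_conj (σ i) (σ j) (w.map σ)).cons (σ j)
    have h₂ := HurwitzEquiv.swap_conj (σ j) (σ i * σ j * (σ i)⁻¹) (σ i :: w.map σ)
    have e : σ j * (σ i * σ j * (σ i)⁻¹) * (σ j)⁻¹ = σ i := by
      rw [mul_inv_eq_iff_eq_mul, ← mul_assoc, mul_inv_eq_iff_eq_mul, ← mul_assoc, σ_braid h]
    rw [e] at h₂
    exact .symm _ _ (.trans _ _ _ h₁ h₂)

/-- All factorizations of `Δₙ²` into Artin generators are Hurwitz equivalent. -/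
theorem hurwitz_equiv_deltaSq_factorizations {n : ℕ} (hn : 2 ≤ n)
    (i j : Fin (n * (n - 1)) → Fin (n - 1))
    (hi : (List.ofFn fun k => σ (i k)).prod = DeltaSq n)
    (hj : (List.ofFn fun k => σ (j k)).prod = DeltaSq n) :
    HurwitzEquiv (List.ofFn fun k => σ (i k)) (List.ofFn fun k => σ (j k)) := by
  have map_ofFn (k : Fin (n * (n - 1)) → Fin (n - 1)) :
      (List.ofFn k).map σ = List.ofFn fun t => σ (k t) := List.map_ofFn
  have h := BraidEquiv.of_prod_eq (u := List.ofFn i) (v := List.ofFn j)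
    (by rw [map_ofFn, map_ofFn, hi, hj])
  have := h.hurwitzEquiv
  rwa [map_ofFn, map_ofFn] at this
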